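/- Fix a finite schema S and k ≥ 0. A k-ary conjunctive query q over S is uniquely characterizable by a finite set of positive and negative examples, with respect to the class of all k-ary conjunctive queries over S, if and only if q is logically equivalent to a c-acyclic conjunctive query. Moreover, if q is c-acyclic, a uniquely characterizing set of examples can be constructed in polynomial time. -/

import Mathlib

/-- A finite relational structure over a schema `S` (with arity function `ar`)
with `k` distinguished elements. -/
structure PStruct (S : Type) (ar : S → ℕ) (k : ℕ) : Type 1 where
  dom : Type
  finite : Finite dom
  facts : ∀ R : S, Set (Fin (ar R) → dom)
  dist : Fin k → dom

attribute [instance] PStruct.finite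

namespace PStruct

variable {S : Type} {ar : S → ℕ} {k : ℕ}

/-- `h` is a homomorphism from `A` to `B`: it preserves all facts and maps
distinguished elements to corresponding distinguished elements. -/
def IsHom (A B : PStruct S ar k) (h : A.dom → B.dom) : Prop :=
  (∀ (R : S) (t : Fin (ar R) → A.dom), t ∈ A.facts R → (fun i => h (t i)) ∈ B.facts R) ∧
  ∀ i : Fin k, h (A.dist i) = B.dist i

/-- `(A,𝐚) → (B,𝐛)`: a homomorphism exists. -/
def HomTo (A B : PStruct S ar k) : Prop := ∃ h, IsHom A B h

/-- Homomorphic equivalence. -/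
def HomEquiv (A B : PStruct S ar k) : Prop := HomTo A B ∧ HomTo B A

/-- Direct product of two structures with distinguished elements. -/
def prod (A B : PStruct S ar k) : PStruct S ar k where
  dom := A.dom × B.dom
  finite := inferInstance
  facts R := {t | (fun i => (t i).1) ∈ A.facts R ∧ (fun i => (t i).2) ∈ B.facts R}
  dist i := (A.dist i, B.dist i)

/-- The facts of a structure, as a type. -/
def Fact (A : PStruct S ar k) : Type := Σ R : S, {t : Fin (ar R) → A.dom // t ∈ A.facts R}

/-- Occurrences of elements in facts: a fact together with a position in it. -/
def Occ (A : PStruct S ar k) : Type :=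
  Σ R : S, {t : Fin (ar R) → A.dom // t ∈ A.facts R} × Fin (ar R)

def Occ.fact {A : PStruct S ar k} (o : Occ A) : Fact A := ⟨o.1, o.2.1⟩

def Occ.elem {A : PStruct S ar k} (o : Occ A) : A.dom := o.2.1.1 o.2.2

/-- Vertices of the (subdivided) incidence graph: elements, occurrences, and facts.
Each occurrence vertex subdivides one edge of the bipartite incidence multigraph,
so that cycles (resp. connectivity) of the incidence multigraph correspond exactly to
cycles (resp. connectivity) of this simple graph. -/
def IncV (A : PStruct S ar k) : Type := A.dom ⊕ (Occ A ⊕ Fact A)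

/-- The incidence graph of a structure, as a simple graph (with each
element-occurrence-in-a-fact edge of the incidence multigraph subdivided). -/
def incGraph (A : PStruct S ar k) : SimpleGraph (IncV A) where
  Adj v w := ∃ o : Occ A,
    (v = Sum.inl o.elem ∧ w = Sum.inr (Sum.inl o)) ∨
    (w = Sum.inl o.elem ∧ v = Sum.inr (Sum.inl o)) ∨
    (v = Sum.inr (Sum.inl o) ∧ w = Sum.inr (Sum.inr o.fact)) ∨
    (w = Sum.inr (Sum.inl o) ∧ v = Sum.inr (Sum.inr o.fact))
  symm := by
    constructor
    rintro v w ⟨o, h⟩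
    exact ⟨o, by tauto⟩
  loopless := by
    constructor
    rintro v ⟨o, (⟨h1, h2⟩ | ⟨h1, h2⟩ | ⟨h1, h2⟩ | ⟨h1, h2⟩)⟩ <;> rw [h1] at h2 <;>
      first
      | exact Sum.inl_ne_inr h2
      | exact Sum.inl_ne_inr (Sum.inr.inj h2)

/-- A structure is acyclic if its incidence graph is acyclic (Berge acyclicity). -/
def Acyclic (A : PStruct S ar k) : Prop := (incGraph A).IsAcyclic

/-- A structure is c-acyclic if every cycle of its incidence graph passes through
a distinguished element. -/
def CAcyclic (A : PStruct S ar k) : Prop :=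
  ∀ (v : IncV A) (c : (incGraph A).Walk v v), c.IsCycle →
    ∃ i : Fin k, Sum.inl (A.dist i) ∈ c.support

/-- A structure is c-connected if every connected component of its incidence graph
contains a distinguished element. -/
def CConnected (A : PStruct S ar k) : Prop :=
  ∀ v : IncV A, ∃ i : Fin k, (incGraph A).Reachable (Sum.inl (A.dist i)) v

/-- The incidence graph is connected. -/
def IncConnected (A : PStruct S ar k) : Prop := (incGraph A).Connected

/-- The fact graph: vertices are facts, with an edge between distinct facts that
share a non-distinguished element. -/
def factGraph (A : PStruct S ar k) : SimpleGraph (Fact A) where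
  Adj f g := f ≠ g ∧ ∃ b : A.dom, (∀ i, b ≠ A.dist i) ∧ (∃ j, f.2.1 j = b) ∧ (∃ j, g.2.1 j = b)
  symm := by
    constructor
    rintro f g ⟨hne, b, h1, h2, h3⟩
    exact ⟨hne.symm, b, h1, h3, h2⟩
  loopless := by constructor; rintro f ⟨hne, -⟩; exact hne rfl

/-- A structure is fg-connected if its fact graph is connected. -/
def FgConnected (A : PStruct S ar k) : Prop := (factGraph A).Connected

/-- A structure is a core if it admits no homomorphism to a proper substructure,
i.e. every endomorphism is surjective on elements and on facts. -/
def IsCore (A : PStruct S ar k) : Prop :=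
  ∀ h : A.dom → A.dom, IsHom A A h →
    Function.Surjective h ∧
    ∀ (R : S) (t : Fin (ar R) → A.dom), t ∈ A.facts R →
      ∃ s ∈ A.facts R, (fun i => h (s i)) = t

/-- Unique Names Property: the distinguished elements are pairwise distinct. -/
def UNP (A : PStruct S ar k) : Prop := Function.Injective A.dist

/-- A structure is safe if every distinguished element occurs in at least one fact. -/
def Safe (A : PStruct S ar k) : Prop :=
  ∀ i : Fin k, ∃ (R : S) (t : Fin (ar R) → A.dom), t ∈ A.facts R ∧ ∃ j, t j = A.dist i

/-- A structure is (the canonical structure of) a conjunctive query iff every element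
occurs in at least one fact (in particular it is safe). -/
def IsCQ (A : PStruct S ar k) : Prop :=
  ∀ x : A.dom, ∃ (R : S) (t : Fin (ar R) → A.dom), t ∈ A.facts R ∧ ∃ j, t j = x

/-- The size of a structure: its number of facts. -/
noncomputable def size (A : PStruct S ar k) : ℕ := Nat.card (Fact A)

/-- The total size of a set of structures: the sum of (size + 1) over its members. -/
noncomputable def totalSize (F : Set (PStruct S ar k)) : ℕ := ∑ᶠ B ∈ F, (size B + 1)

/-- `F` is a frontier for `A` with respect to the class `C`. -/
def IsFrontier (C : Set (PStruct S ar k)) (A : PStruct S ar k)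
    (F : Set (PStruct S ar k)) : Prop :=
  F.Finite ∧
  (∀ B ∈ F, HomTo B A) ∧
  (∀ B ∈ F, ¬ HomTo A B) ∧
  ∀ C' ∈ C, HomTo C' A → ¬ HomTo A C' → ∃ B ∈ F, HomTo C' B

/-- `D` is a finite duality for `A` with respect to the class `C`. -/
def IsDuality (C : Set (PStruct S ar k)) (A : PStruct S ar k)
    (D : Set (PStruct S ar k)) : Prop :=
  D.Finite ∧ ∀ C' ∈ C, (HomTo A C' ↔ ∀ B ∈ D, ¬ HomTo C' B)

/-- A conjunctive query (given by its canonical structure `Q`) fits the example sets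
`(E⁺, E⁻)`: every example in `E⁺` is positive and every example in `E⁻` is negative.
(By Chandra–Merlin, `(A,𝐚)` is a positive example for `Q` iff `Q → (A,𝐚)`.) -/
def Fits (Q : PStruct S ar k) (Ep Em : Set (PStruct S ar k)) : Prop :=
  (∀ E ∈ Ep, HomTo Q E) ∧ (∀ E ∈ Em, ¬ HomTo Q E)

/-- `(E⁺, E⁻)` uniquely characterizes the CQ `Q` with respect to the class `C` of CQs
(all represented by their canonical structures): `Q` fits, and every member of `C`
that fits is logically equivalent (i.e. homomorphically equivalent) to `Q`. -/
def UniquelyCharacterizes (Ep Em : Set (PStruct S ar k)) (Q : PStruct S ar k)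
    (C : Set (PStruct S ar k)) : Prop :=
  Fits Q Ep Em ∧ ∀ Q' ∈ C, Fits Q' Ep Em → HomEquiv Q Q'

end PStruct

open PStruct

namespace PStruct

section Basic

variable {S : Type} {ar : S → ℕ} {k : ℕ}

theorem IsHom.comp {A B C : PStruct S ar k} {f : A.dom → B.dom} {g : B.dom → C.dom}
    (hg : IsHom B C g) (hf : IsHom A B f) : IsHom A C (fun x => g (f x)) :=
  ⟨fun R t ht => hg.1 R _ (hf.1 R t ht), fun i => (congrArg g (hf.2 i)).trans (hg.2 i)⟩

theorem isHom_id (A : PStruct S ar k) : IsHom A A (fun x => x) :=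
  ⟨fun _ _ ht => ht, fun _ => rfl⟩

theorem HomTo.trans {A B C : PStruct S ar k} (h1 : HomTo A B) (h2 : HomTo B C) : HomTo A C := by
  obtain ⟨f, hf⟩ := h1
  obtain ⟨g, hg⟩ := h2
  exact ⟨_, hg.comp hf⟩

theorem HomTo.rfl' (A : PStruct S ar k) : HomTo A A := ⟨_, isHom_id A⟩

/-- Unique characterizations transfer along homomorphic equivalence. -/
theorem UniquelyCharacterizes.congr {Ep Em C : Set (PStruct S ar k)} {Q Q' : PStruct S ar k}
    (h : UniquelyCharacterizes Ep Em Q C) (e : HomEquiv Q Q') :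
    UniquelyCharacterizes Ep Em Q' C := by
  refine ⟨⟨fun E hE => e.2.trans (h.1.1 E hE), fun E hE hh => h.1.2 E hE (e.1.trans hh)⟩, ?_⟩
  intro P hP hf
  obtain ⟨a, b⟩ := h.2 P hP hf
  exact ⟨e.2.trans a, b.trans e.1⟩

/-- Endomorphisms of a core are invertible. -/
theorem IsCore.exists_inv {A : PStruct S ar k} (hA : IsCore A) {e : A.dom → A.dom}
    (he : IsHom A A e) : ∃ u : A.dom → A.dom, IsHom A A u ∧ ∀ x, e (u x) = x := by
  obtain ⟨hs, hf⟩ := hA e he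
  have hinj : Function.Injective e := Finite.injective_iff_surjective.mpr hs
  choose u hu using hs
  refine ⟨u, ⟨?_, ?_⟩, hu⟩
  · intro R t ht
    obtain ⟨s, hs, hst⟩ := hf R t ht
    have : (fun i => u (t i)) = s := by
      funext i
      apply hinj
      rw [hu, ← hst]
    rw [this]; exact hs
  · intro i
    apply hinj
    rw [hu, he.2]

instance instFiniteFact [Finite S] (A : PStruct S ar k) : Finite (Fact A) := by
  unfold Fact; infer_instance

instance instFiniteOcc [Finite S] (A : PStruct S ar k) : Finite (Occ A) := by
  unfold Occ; infer_instance

/-- The image of an endomorphism. -/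
def img (A : PStruct S ar k) (h : A.dom → A.dom) (hh : IsHom A A h) : PStruct S ar k where
  dom := Set.range h
  finite := inferInstance
  facts R := {t | ∃ s ∈ A.facts R, ∀ i, h (s i) = (t i : A.dom)}
  dist i := ⟨A.dist i, ⟨A.dist i, hh.2 i⟩⟩

theorem img_incl {A : PStruct S ar k} {h : A.dom → A.dom} (hh : IsHom A A h) :
    IsHom (img A h hh) A (fun x => x.1) := by
  refine ⟨?_, fun _ => rfl⟩
  rintro R t ⟨s, hs, hst⟩
  have := hh.1 R s hs
  have e : (fun i => h (s i)) = fun i => (t i).1 := funext hst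
  rwa [e] at this

theorem img_proj {A : PStruct S ar k} {h : A.dom → A.dom} (hh : IsHom A A h) :
    IsHom A (img A h hh) (fun x => ⟨h x, x, rfl⟩) :=
  ⟨fun _ t ht => ⟨t, ht, fun _ => rfl⟩, fun i => Subtype.ext (hh.2 i)⟩

theorem img_isCQ {A : PStruct S ar k} {h : A.dom → A.dom} (hh : IsHom A A h) (hA : IsCQ A) :
    IsCQ (img A h hh) := by
  rintro ⟨_, x, rfl⟩
  obtain ⟨R, t, ht, j, hj⟩ := hA x
  exact ⟨R, _, (img_proj hh).1 R t ht, j, Subtype.ext (by simp [hj])⟩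

/-- The map on facts induced by a homomorphism. -/
def IsHom.mapFact {A B : PStruct S ar k} {f : A.dom → B.dom} (hf : IsHom A B f) (x : Fact A) :
    Fact B := ⟨x.1, fun i => f (x.2.1 i), hf.1 _ _ x.2.2⟩

theorem IsHom.mapFact_injective {A B : PStruct S ar k} {f : A.dom → B.dom} (hf : IsHom A B f)
    (hinj : Function.Injective f) : Function.Injective hf.mapFact := by
  rintro ⟨R, t, ht⟩ ⟨R', t', ht'⟩ h
  obtain ⟨h0, h⟩ := Sigma.mk.inj_iff.mp h
  dsimp only at h0
  subst h0
  simp only [heq_eq_eq, Subtype.mk.injEq] at h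
  have : t = t' := funext fun i => hinj (congrFun h i)
  subst this
  rfl

/-- The map on occurrences induced by a homomorphism. -/
def IsHom.mapOcc {A B : PStruct S ar k} {f : A.dom → B.dom} (hf : IsHom A B f) (x : Occ A) :
    Occ B := ⟨x.1, ⟨fun i => f (x.2.1.1 i), hf.1 _ _ x.2.1.2⟩, x.2.2⟩

theorem IsHom.mapOcc_injective {A B : PStruct S ar k} {f : A.dom → B.dom} (hf : IsHom A B f)
    (hinj : Function.Injective f) : Function.Injective hf.mapOcc := by
  rintro ⟨R, ⟨t, ht⟩, p⟩ ⟨R', ⟨t', ht'⟩, p'⟩ h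
  obtain ⟨h0, h⟩ := Sigma.mk.inj_iff.mp h
  dsimp only at h0
  subst h0
  obtain ⟨h, h1⟩ := Prod.ext_iff.mp (eq_of_heq h)
  dsimp only at h1
  subst h1
  have : t = t' := funext fun i => hinj (congrFun (Subtype.mk.inj h) i)
  subst this
  rfl

theorem size_le_of_injective [Finite S] {A B : PStruct S ar k} {f : A.dom → B.dom}
    (hf : IsHom A B f) (hinj : Function.Injective f) : size A ≤ size B :=
  Nat.card_le_card_of_injective _ (hf.mapFact_injective hinj)

/-- The graph homomorphism of incidence graphs induced by a homomorphism. -/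
def IsHom.mapInc {A B : PStruct S ar k} {f : A.dom → B.dom} (hf : IsHom A B f) :
    incGraph A →g incGraph B where
  toFun := Sum.map f (Sum.map hf.mapOcc hf.mapFact)
  map_rel' := by
    rintro v w ⟨o, h⟩
    refine ⟨hf.mapOcc o, ?_⟩
    rcases h with (⟨rfl, rfl⟩ | ⟨rfl, rfl⟩ | ⟨rfl, rfl⟩ | ⟨rfl, rfl⟩)
    · exact Or.inl ⟨rfl, rfl⟩
    · exact Or.inr (Or.inl ⟨rfl, rfl⟩)
    · exact Or.inr (Or.inr (Or.inl ⟨rfl, rfl⟩))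
    · exact Or.inr (Or.inr (Or.inr ⟨rfl, rfl⟩))

theorem IsHom.mapInc_injective {A B : PStruct S ar k} {f : A.dom → B.dom} (hf : IsHom A B f)
    (hinj : Function.Injective f) : Function.Injective hf.mapInc :=
  hinj.sumMap ((hf.mapOcc_injective hinj).sumMap (hf.mapFact_injective hinj))

theorem CAcyclic.of_injective {A B : PStruct S ar k} {f : A.dom → B.dom} (hf : IsHom A B f)
    (hinj : Function.Injective f) (hB : CAcyclic B) : CAcyclic A := by
  intro v c hc
  have hi := hf.mapInc_injective hinj
  obtain ⟨i, h⟩ := hB _ (c.map hf.mapInc)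
    ((SimpleGraph.Walk.isCycle_map_iff_of_injective hi).mpr hc)
  rw [SimpleGraph.Walk.support_map] at h
  obtain ⟨w, hw, hw'⟩ := List.mem_map.mp h
  refine ⟨i, ?_⟩
  have : w = Sum.inl (A.dist i) := by
    apply hi
    rw [hw', ← hf.2 i]
    rfl
  rwa [this] at hw

/-- Every finite structure has a core, which embeds into it. -/
theorem exists_core [Finite S] (n : ℕ) : ∀ (A : PStruct S ar k), IsCQ A →
    Nat.card A.dom + size A ≤ n →
    ∃ B : PStruct S ar k, IsCQ B ∧ IsCore B ∧ HomTo A B ∧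
      ∃ f : B.dom → A.dom, IsHom B A f ∧ Function.Injective f := by
  induction n using Nat.strong_induction_on with
  | _ n ih =>
  intro A hA hn
  by_cases hc : IsCore A
  · exact ⟨A, hA, hc, HomTo.rfl' A, _, isHom_id A, fun _ _ h => h⟩
  · unfold IsCore at hc
    push Not at hc
    obtain ⟨h, hh, hns⟩ := hc
    have hinj : Function.Injective (fun x : (img A h hh).dom => (x.1 : A.dom)) :=
      Subtype.val_injective
    have hle1 : Nat.card (img A h hh).dom ≤ Nat.card A.dom :=
      Nat.card_le_card_of_injective _ hinj
    have hle2 := size_le_of_injective (img_incl hh) hinj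
    have hlt : Nat.card (img A h hh).dom + size (img A h hh) < Nat.card A.dom + size A := by
      by_cases hs : Function.Surjective h
      · obtain ⟨R, t, ht, hts⟩ := hns hs
        have : size (img A h hh) < size A := by
          rcases lt_or_eq_of_le hle2 with h' | h'
          · exact h'
          · exfalso
            have hb := ((img_incl hh).mapFact_injective hinj).bijective_of_nat_card_le h'.ge
            obtain ⟨⟨R', t', s, hs, hst⟩, hx⟩ := hb.2 ⟨R, t, ht⟩
            obtain ⟨h0, hx⟩ := Sigma.mk.inj_iff.mp hx
            dsimp only at h0
            subst h0
            simp only [heq_eq_eq, Subtype.mk.injEq] at hx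
            exact hts s hs (by rw [← hx]; exact funext hst)
        omega
      · have : Nat.card (img A h hh).dom < Nat.card A.dom := by
          rcases lt_or_eq_of_le hle1 with h' | h'
          · exact h'
          · exfalso
            have hb := hinj.bijective_of_nat_card_le h'.ge
            apply hs
            intro x
            obtain ⟨⟨y, z, hz⟩, rfl⟩ := hb.2 x
            exact ⟨z, hz⟩
        omega
    obtain ⟨B, hB1, hB2, hB3, f, hf, hfi⟩ := ih _ (lt_of_lt_of_le hlt hn) (img A h hh)
      (img_isCQ hh hA) le_rfl
    exact ⟨B, hB1, hB2, HomTo.trans ⟨_, img_proj hh⟩ hB3, _, (img_incl hh).comp hf,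
      hinj.comp hfi⟩

end Basic

end PStruct

namespace PStruct

section Forest

variable {S : Type} {ar : S → ℕ} {k : ℕ}

/-- Being a distinguished element. -/
def IsDist (A : PStruct S ar k) (a : A.dom) : Prop := ∃ i, a = A.dist i

/-- The vertex of an element. -/
def vE (A : PStruct S ar k) (a : A.dom) : IncV A := Sum.inl a
/-- The vertex of an occurrence. -/
def vO (A : PStruct S ar k) (o : Occ A) : IncV A := Sum.inr (Sum.inl o)
/-- The vertex of a fact. -/
def vF (A : PStruct S ar k) (f : Fact A) : IncV A := Sum.inr (Sum.inr f)

theorem vE_inj {A : PStruct S ar k} {a b : A.dom} (h : vE A a = vE A b) : a = b :=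
  Sum.inl_injective h
theorem vO_inj {A : PStruct S ar k} {a b : Occ A} (h : vO A a = vO A b) : a = b :=
  Sum.inl_injective (Sum.inr_injective h)
theorem vF_inj {A : PStruct S ar k} {a b : Fact A} (h : vF A a = vF A b) : a = b :=
  Sum.inr_injective (Sum.inr_injective h)
theorem vE_ne_vO {A : PStruct S ar k} {a : A.dom} {b : Occ A} : vE A a ≠ vO A b :=
  Sum.inl_ne_inr
theorem vE_ne_vF {A : PStruct S ar k} {a : A.dom} {b : Fact A} : vE A a ≠ vF A b :=
  Sum.inl_ne_inr
theorem vO_ne_vF {A : PStruct S ar k} {a : Occ A} {b : Fact A} : vO A a ≠ vF A b :=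
  fun h => Sum.inl_ne_inr (Sum.inr_injective h)

theorem IncV.cases {A : PStruct S ar k} (v : IncV A) :
    (∃ a, v = vE A a) ∨ (∃ o, v = vO A o) ∨ (∃ f, v = vF A f) := by
  rcases v with a | o | f
  · exact Or.inl ⟨a, rfl⟩
  · exact Or.inr (Or.inl ⟨o, rfl⟩)
  · exact Or.inr (Or.inr ⟨f, rfl⟩)

/-- Vertices that are not distinguished elements. -/
def NDV (A : PStruct S ar k) (v : IncV A) : Prop := ∀ i, v ≠ vE A (A.dist i)

/-- The incidence graph, with edges at distinguished elements removed. -/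
def ndGraph (A : PStruct S ar k) : SimpleGraph (IncV A) where
  Adj v w := (incGraph A).Adj v w ∧ NDV A v ∧ NDV A w
  symm := by
    constructor
    rintro v w ⟨h1, h2, h3⟩
    exact ⟨h1.symm, h3, h2⟩
  loopless := by
    constructor
    rintro v ⟨h, -⟩
    exact h.ne rfl

theorem ndGraph_le (A : PStruct S ar k) : ndGraph A ≤ incGraph A := fun _ _ h => h.1

theorem NDV_vE {A : PStruct S ar k} {a : A.dom} : NDV A (vE A a) ↔ ¬ IsDist A a := by
  constructor
  · rintro h ⟨i, rfl⟩; exact h i rfl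
  · intro h i hi; exact h ⟨i, vE_inj hi⟩

theorem NDV_vO {A : PStruct S ar k} (o : Occ A) : NDV A (vO A o) := fun _ h => vE_ne_vO h.symm
theorem NDV_vF {A : PStruct S ar k} (o : Fact A) : NDV A (vF A o) := fun _ h => vE_ne_vF h.symm

theorem ndGraph_adj_EO {A : PStruct S ar k} (o : Occ A) (h : ¬ IsDist A o.elem) :
    (ndGraph A).Adj (vE A o.elem) (vO A o) :=
  ⟨⟨o, Or.inl ⟨rfl, rfl⟩⟩, NDV_vE.mpr h, NDV_vO o⟩

theorem ndGraph_adj_OF {A : PStruct S ar k} (o : Occ A) :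
    (ndGraph A).Adj (vO A o) (vF A o.fact) :=
  ⟨⟨o, Or.inr (Or.inr (Or.inl ⟨rfl, rfl⟩))⟩, NDV_vO o, NDV_vF _⟩

theorem ndGraph_adj_cases {A : PStruct S ar k} {v w : IncV A} (h : (ndGraph A).Adj v w) :
    ∃ o : Occ A, (¬ IsDist A o.elem ∧ v = vE A o.elem ∧ w = vO A o) ∨
      (¬ IsDist A o.elem ∧ w = vE A o.elem ∧ v = vO A o) ∨
      (v = vO A o ∧ w = vF A o.fact) ∨ (w = vO A o ∧ v = vF A o.fact) := by
  obtain ⟨⟨o, h⟩, h1, h2⟩ := h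
  refine ⟨o, ?_⟩
  rcases h with (⟨rfl, rfl⟩ | ⟨rfl, rfl⟩ | ⟨rfl, rfl⟩ | ⟨rfl, rfl⟩)
  · exact Or.inl ⟨NDV_vE.mp h1, rfl, rfl⟩
  · exact Or.inr (Or.inl ⟨NDV_vE.mp h2, rfl, rfl⟩)
  · exact Or.inr (Or.inr (Or.inl ⟨rfl, rfl⟩))
  · exact Or.inr (Or.inr (Or.inr ⟨rfl, rfl⟩))

theorem CAcyclic.ndGraph_isAcyclic {A : PStruct S ar k} (hA : CAcyclic A) :
    (ndGraph A).IsAcyclic := by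
  intro v c hc
  obtain ⟨i, hi⟩ := hA v (c.mapLe (ndGraph_le A)) (hc.mapLe (ndGraph_le A))
  have hi' : vE A (A.dist i) ∈ c.support := by
    have h2 : vE A (A.dist i) ∈ (c.mapLe (ndGraph_le A)).support := hi
    simpa using h2
  obtain ⟨y, -, hy⟩ := SimpleGraph.adj_of_mem_walk_support c hc.not_nil hi'
  exact hy.2.1 i rfl

theorem cAcyclic_of_ndGraph {A : PStruct S ar k} (hA : (ndGraph A).IsAcyclic) : CAcyclic A := by
  intro v c hc
  by_contra hne
  push Not at hne
  have key : ∀ e ∈ c.edges, e ∈ (ndGraph A).edgeSet := by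
    intro e
    induction e using Sym2.ind with
    | _ x y =>
    intro he
    refine ⟨c.adj_of_mem_edges he, ?_, ?_⟩
    · intro i hi
      have := c.fst_mem_support_of_mem_edges he
      rw [show x = vE A (A.dist i) from hi] at this
      exact hne i this
    · intro i hi
      have := c.snd_mem_support_of_mem_edges he
      rw [show y = vE A (A.dist i) from hi] at this
      exact hne i this
  exact hA (c.transfer _ key) (hc.transfer key)

/-- Unique lower neighbours in a rooted forest. -/
theorem lower_unique {V : Type} {G : SimpleGraph V} (hG : G.IsAcyclic) {r u v w : V}
    (hr : G.Reachable r v) (hu : G.Adj v u) (hw : G.Adj v w)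
    (hlu : G.dist r u < G.dist r v) (hlw : G.dist r w < G.dist r v) : u = w := by
  obtain ⟨p, hp, hpl⟩ := hr.exists_path_of_dist
  have key : ∀ x, G.Adj v x → G.dist r x < G.dist r v → x = p.penultimate := by
    intro x hx hlx
    apply hG.eq_penultimate_of_adj_end hp hx
    by_contra hns
    obtain ⟨q, hq, hql⟩ := (hr.trans hx.reachable).exists_path_of_dist
    have hv : v ∈ q.support :=
      hG.mem_support_of_ne_mem_support_of_adj_of_isPath hq hp hx.symm hns
    have := hG.path_concat hp hq hx hv
    have h2 := congrArg SimpleGraph.Walk.length this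
    rw [SimpleGraph.Walk.length_concat] at h2
    omega
  rw [key u hu hlu, key w hw hlw]

theorem exists_lower {V : Type} {G : SimpleGraph V} {r v : V}
    (hr : G.Reachable r v) (hne : r ≠ v) : ∃ u, G.Adj v u ∧ G.dist r u < G.dist r v := by
  obtain ⟨p, hp⟩ := hr.exists_walk_length_eq_dist
  have hn : ¬ p.Nil := fun h => hne h.eq
  refine ⟨p.penultimate, (p.adj_penultimate hn).symm, ?_⟩
  have h1 := SimpleGraph.dist_le p.dropLast
  have h2 : p.dropLast.length + 1 = p.length := p.length_dropLast_add_one hn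
  omega

/-- A rooted-forest orientation of the non-distinguished part of a structure. -/
structure Ranks (A : PStruct S ar k) where
  re : A.dom → ℕ
  rf : Fact A → ℕ
  ne : ∀ o : Occ A, ¬ IsDist A o.elem → re o.elem ≠ rf o.fact
  up : ∀ o o' : Occ A, ¬ IsDist A o.elem → ¬ IsDist A o'.elem → o.fact = o'.fact →
    re o.elem < rf o.fact → re o'.elem < rf o'.fact → o = o'
  down : ∀ o o' : Occ A, ¬ IsDist A o.elem → o.elem = o'.elem →
    rf o.fact < re o.elem → rf o'.fact < re o'.elem → o = o'

theorem CAcyclic.exists_ranks {A : PStruct S ar k} (hA : CAcyclic A) : Nonempty (Ranks A) := by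
  classical
  have hG := hA.ndGraph_isAcyclic
  set G := ndGraph A with hGdef
  -- choose roots
  have hroot : ∀ c : G.ConnectedComponent, ∃ r : IncV A, G.connectedComponentMk r = c ∧
      ∀ o, r ≠ vO A o := by
    intro c
    induction c using SimpleGraph.ConnectedComponent.ind with
    | _ v =>
    rcases IncV.cases v with ⟨a, rfl⟩ | ⟨o, rfl⟩ | ⟨f, rfl⟩
    · exact ⟨_, rfl, fun o => vE_ne_vO⟩
    · refine ⟨vF A o.fact, ?_, fun o' => vO_ne_vF.symm⟩
      exact SimpleGraph.ConnectedComponent.eq.mpr (ndGraph_adj_OF o).symm.reachable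
    · exact ⟨_, rfl, fun o => vO_ne_vF.symm⟩
  choose root hroot1 hroot2 using hroot
  let rt : IncV A → IncV A := fun v => root (G.connectedComponentMk v)
  have hreach : ∀ v, G.Reachable (rt v) v := fun v =>
    SimpleGraph.ConnectedComponent.eq.mp (hroot1 _)
  have hadj : ∀ {v w}, G.Adj v w → rt v = rt w := by
    intro v w h
    have : G.connectedComponentMk v = G.connectedComponentMk w :=
      SimpleGraph.ConnectedComponent.eq.mpr h.reachable
    simp only [rt, this]
  let l : IncV A → ℕ := fun v => G.dist (rt v) v
  have hlne : ∀ {v w}, G.Adj v w → l v ≠ l w := by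
    intro v w h
    simp only [l, ← hadj h]
    exact hG.dist_ne_of_adj h (hreach v)
  have hlu : ∀ {u v w}, G.Adj v u → G.Adj v w → l u < l v → l w < l v → u = w := by
    intro u v w hu hw h1 h2
    simp only [l, ← hadj hu] at h1
    simp only [l, ← hadj hw] at h2
    exact lower_unique hG (hreach v) hu hw h1 h2
  have hlo : ∀ o, ∃ u, G.Adj (vO A o) u ∧ l u < l (vO A o) := by
    intro o
    obtain ⟨u, hu, h⟩ := exists_lower (hreach (vO A o)) (hroot2 _ o)
    refine ⟨u, hu, ?_⟩
    simp only [l, ← hadj hu]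
    exact h
  have hcase : ∀ o : Occ A, ¬ IsDist A o.elem →
      (l (vE A o.elem) < l (vO A o) ∧ l (vO A o) < l (vF A o.fact)) ∨
      (l (vF A o.fact) < l (vO A o) ∧ l (vO A o) < l (vE A o.elem)) := by
    intro o ho
    have a1 := (ndGraph_adj_EO o ho).symm
    have a2 := ndGraph_adj_OF o
    have n1 := hlne a1
    have n2 := hlne a2
    have n3 : ¬ (l (vE A o.elem) < l (vO A o) ∧ l (vF A o.fact) < l (vO A o)) := by
      rintro ⟨h1, h2⟩
      exact vE_ne_vF (hlu a1 a2 h1 h2)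
    have n4 : l (vE A o.elem) < l (vO A o) ∨ l (vF A o.fact) < l (vO A o) := by
      obtain ⟨u, hu, h⟩ := hlo o
      obtain ⟨o', h' | h' | h' | h'⟩ := ndGraph_adj_cases hu
      · exact absurd h'.2.1.symm vE_ne_vO
      · obtain ⟨-, rfl, h3⟩ := h'
        rw [vO_inj h3] at h ⊢; exact Or.inl h
      · obtain ⟨h3, rfl⟩ := h'
        rw [vO_inj h3] at h ⊢; exact Or.inr h
      · exact absurd h'.2 vO_ne_vF
    omega
  refine ⟨⟨fun a => l (vE A a), fun f => l (vF A f), ?_, ?_, ?_⟩⟩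
  · intro o ho
    have := hcase o ho
    omega
  · intro o o' ho ho' hf h1 h2
    have c1 := hcase o ho
    have c2 := hcase o' ho'
    have a1 := (ndGraph_adj_OF o).symm
    have a2 := (ndGraph_adj_OF o').symm
    rw [← hf] at a2 c2 h2
    exact vO_inj (hlu a1 a2 (by omega) (by omega))
  · intro o o' ho hf h1 h2
    have ho' := ho
    rw [hf] at ho'
    have c1 := hcase o ho
    have c2 := hcase o' ho'
    have a1 := (ndGraph_adj_EO o ho)
    have a2 := (ndGraph_adj_EO o' ho')
    rw [← hf] at a2 c2 h2
    exact vO_inj (hlu a1 a2 (by omega) (by omega))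

end Forest

end PStruct

namespace PStruct

section Necessity

variable {S : Type} {ar : S → ℕ} {k : ℕ}

/-- The layered structure: copies of `A` indexed by `Fin (n+2)`, in which the occurrence `o`
always jumps to another layer. -/
def layered (A : PStruct S ar k) (o : Occ A) (n : ℕ) : PStruct S ar k where
  dom := A.dom × Fin (n + 2)
  finite := inferInstance
  facts R := {t | ∃ h : (fun p => (t p).1) ∈ A.facts R, ∃ i : Fin (n + 2), ∀ p,
    ¬ IsDist A (t p).1 → ((t p).2 = i ↔ (⟨R, ⟨fun p => (t p).1, h⟩, p⟩ : Occ A) ≠ o)}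
  dist i := (A.dist i, 0)

theorem layered_proj (A : PStruct S ar k) (o : Occ A) (n : ℕ) :
    IsHom (layered A o n) A (fun x => x.1) :=
  ⟨fun _ _ ⟨h, _⟩ => h, fun _ => rfl⟩

theorem layered_isCQ {A : PStruct S ar k} (hA : IsCQ A) (o : Occ A) (n : ℕ) :
    IsCQ (layered A o n) := by
  classical
  rintro ⟨a, i⟩
  obtain ⟨R, t, ht, p, rfl⟩ := hA a
  obtain ⟨j, hj⟩ : ∃ j : Fin (n + 2), j ≠ i := exists_ne i
  let oc : Fin (ar R) → Occ A := fun q => ⟨R, ⟨t, ht⟩, q⟩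
  by_cases hp : oc p = o
  · refine ⟨R, fun q => (t q, if q = p then i else if oc q = o then i else j), ⟨ht, j, ?_⟩, p, ?_⟩
    · intro q _
      change (if q = p then i else if oc q = o then i else j) = j ↔ oc q ≠ o
      by_cases h1 : q = p
      · subst h1; simp [hp, hj.symm]
      · by_cases h2 : oc q = o <;> simp [h1, h2, hj.symm]
    · simp only [if_true]; rfl
  · refine ⟨R, fun q => (t q, if q = p then i else if oc q = o then j else i), ⟨ht, i, ?_⟩, p, ?_⟩
    · intro q _
      change (if q = p then i else if oc q = o then j else i) = i ↔ oc q ≠ o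
      by_cases h1 : q = p
      · subst h1; simp [hp]
      · by_cases h2 : oc q = o <;> simp [h1, h2, hj]
    · simp only [if_true]; rfl

theorem layered_homTo {A E : PStruct S ar k} (o : Occ A) (n : ℕ)
    (hn : Nat.card (A.dom → E.dom) ≤ n) (h : HomTo (layered A o n) E) : HomTo A E := by
  classical
  obtain ⟨h, hh⟩ := h
  let H : Fin (n + 2) → A.dom → E.dom := fun i a => if IsDist A a then h (a, 0) else h (a, i)
  have hni : ¬ Function.Injective H := by
    intro hi
    have := Nat.card_le_card_of_injective H hi
    simp only [Nat.card_fin] at this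
    omega
  simp only [Function.Injective] at hni
  push Not at hni
  obtain ⟨i, j, hij, hne⟩ := hni
  refine ⟨H i, ?_, ?_⟩
  · intro R t ht
    let oc : Fin (ar R) → Occ A := fun q => ⟨R, ⟨t, ht⟩, q⟩
    have key := hh.1 R (fun q => (t q, if IsDist A (t q) then 0 else if oc q = o then j else i)) (by
      refine ⟨ht, i, ?_⟩
      intro q hq
      change ¬ IsDist A (t q) at hq
      change (if IsDist A (t q) then 0 else if oc q = o then j else i) = i ↔ oc q ≠ o
      by_cases h2 : oc q = o <;> simp [hq, h2, hne.symm])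
    convert key using 1
    funext q
    by_cases h1 : IsDist A (t q)
    · simp [H, h1]
    · by_cases h2 : oc q = o
      · rw [hij]; simp [H, h1, h2]
      · simp [H, h1, h2]
  · intro l
    have : IsDist A (A.dist l) := ⟨l, rfl⟩
    simp only [H, this, if_true]
    exact hh.2 l

theorem reachable_const {V β : Type} {G : SimpleGraph V} (f : V → β)
    (h : ∀ v w, G.Adj v w → f v = f w) {v w : V} (hr : G.Reachable v w) : f v = f w := by
  obtain ⟨p⟩ := hr
  induction p with
  | nil => rfl
  | cons ha _ ih => exact (h _ _ ha).trans ih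

theorem not_homTo_layered {A : PStruct S ar k} (hc : IsCore A) (hA : ¬ CAcyclic A) :
    ∃ o : Occ A, ∀ n, ¬ HomTo A (layered A o n) := by
  classical
  have h1 : ¬ (ndGraph A).IsAcyclic := fun h => hA (cAcyclic_of_ndGraph h)
  rw [SimpleGraph.isAcyclic_iff_forall_adj_isBridge] at h1
  push Not at h1
  obtain ⟨v, w, hvw, hb⟩ := h1
  rw [SimpleGraph.isBridge_iff, not_not] at hb
  -- orient the edge
  have h2 : ∃ o : Occ A,
      (¬ IsDist A o.elem ∧
        ((ndGraph A).deleteEdges {s(vE A o.elem, vO A o)}).Reachable (vE A o.elem) (vO A o)) ∨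
      ((ndGraph A).deleteEdges {s(vO A o, vF A o.fact)}).Reachable (vO A o) (vF A o.fact) := by
    obtain ⟨o, h | h | h | h⟩ := ndGraph_adj_cases hvw
    · obtain ⟨h0, rfl, rfl⟩ := h
      exact ⟨o, Or.inl ⟨h0, hb⟩⟩
    · obtain ⟨h0, rfl, rfl⟩ := h
      refine ⟨o, Or.inl ⟨h0, ?_⟩⟩
      rw [Sym2.eq_swap]
      exact hb.symm
    · obtain ⟨rfl, rfl⟩ := h
      exact ⟨o, Or.inr hb⟩
    · obtain ⟨rfl, rfl⟩ := h
      refine ⟨o, Or.inr ?_⟩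
      rw [Sym2.eq_swap]
      exact hb.symm
  obtain ⟨o, ho⟩ := h2
  refine ⟨o, ?_⟩
  rintro n ⟨φ, hφ⟩
  obtain ⟨u, hu, hu2⟩ := hc.exists_inv ((layered_proj A o n).comp hφ)
  have hs := hφ.comp hu
  set s : A.dom → (layered A o n).dom := fun x => φ (u x) with hsdef
  have hs1 : ∀ x, (s x).1 = x := hu2
  let lay : A.dom → Fin (n + 2) := fun x => (s x).2
  have hf : ∀ f : Fact A, ∃ i : Fin (n + 2), ∀ p, ¬ IsDist A (f.2.1 p) →
      (lay (f.2.1 p) = i ↔ (⟨f.1, f.2, p⟩ : Occ A) ≠ o) := by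
    rintro ⟨R, t, ht⟩
    obtain ⟨h, i, hi⟩ := hs.1 R t ht
    refine ⟨i, fun p hp => ?_⟩
    have := hi p (by rw [hs1]; exact hp)
    have e : (fun p => (s (t p)).1) = t := funext fun p => hs1 _
    simp only [e] at this
    exact this
  choose lf hlf using hf
  have hocc : ∀ o' : Occ A, ¬ IsDist A o'.elem → (lay o'.elem = lf o'.fact ↔ o' ≠ o) :=
    fun o' h => hlf o'.fact o'.2.2 h
  rcases ho with ⟨h0, hr⟩ | hr
  · let L : IncV A → Fin (n + 2) := Sum.elim lay (Sum.elim (fun o => lf o.fact) lf)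
    have := reachable_const L (by
      intro v w h
      rw [SimpleGraph.deleteEdges_adj] at h
      obtain ⟨h, hne⟩ := h
      obtain ⟨o', h' | h' | h' | h'⟩ := ndGraph_adj_cases h
      · obtain ⟨h0', rfl, rfl⟩ := h'
        exact (hocc o' h0').mpr (by rintro rfl; exact hne rfl)
      · obtain ⟨h0', rfl, rfl⟩ := h'
        exact ((hocc o' h0').mpr (by rintro rfl; exact hne Sym2.eq_swap)).symm
      · obtain ⟨rfl, rfl⟩ := h'; rfl
      · obtain ⟨rfl, rfl⟩ := h'; rfl) hr
    exact (hocc o h0).mp this rfl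
  · by_cases h0 : IsDist A o.elem
    · have := reachable_const (fun v => v = vO A o) (by
        intro v w h
        rw [SimpleGraph.deleteEdges_adj] at h
        obtain ⟨h, hne⟩ := h
        obtain ⟨o', h' | h' | h' | h'⟩ := ndGraph_adj_cases h
        · obtain ⟨h0', rfl, rfl⟩ := h'
          have : o' ≠ o := by rintro rfl; exact h0' h0
          simp only [eq_iff_iff]
          exact ⟨fun h => absurd h vE_ne_vO, fun h => absurd (vO_inj h) this⟩
        · obtain ⟨h0', rfl, rfl⟩ := h'
          have : o' ≠ o := by rintro rfl; exact h0' h0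
          simp only [eq_iff_iff]
          exact ⟨fun h => absurd (vO_inj h) this, fun h => absurd h vE_ne_vO⟩
        · obtain ⟨rfl, rfl⟩ := h'
          have : o' ≠ o := by rintro rfl; exact hne rfl
          simp only [eq_iff_iff]
          exact ⟨fun h => absurd (vO_inj h) this, fun h => absurd h.symm vO_ne_vF⟩
        · obtain ⟨rfl, rfl⟩ := h'
          have : o' ≠ o := by rintro rfl; exact hne Sym2.eq_swap
          simp only [eq_iff_iff]
          exact ⟨fun h => absurd h.symm vO_ne_vF, fun h => absurd (vO_inj h) this⟩) hr
      have h3 : vF A o.fact = vO A o := this.mp rfl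
      exact vO_ne_vF h3.symm
    · let L : IncV A → Fin (n + 2) := Sum.elim lay (Sum.elim
        (fun o => if IsDist A o.elem then lf o.fact else lay o.elem) lf)
      have hLO : ∀ o' : Occ A, L (vO A o') = if IsDist A o'.elem then lf o'.fact else lay o'.elem :=
        fun _ => rfl
      have hLE : ∀ a, L (vE A a) = lay a := fun _ => rfl
      have hLF : ∀ a, L (vF A a) = lf a := fun _ => rfl
      have hOF : ∀ o', o' ≠ o → L (vO A o') = L (vF A o'.fact) := by
        intro o' hne
        rw [hLO, hLF]
        split_ifs with hd
        · rfl
        · exact (hocc o' hd).mpr hne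
      have := reachable_const L (by
        intro v w h
        rw [SimpleGraph.deleteEdges_adj] at h
        obtain ⟨h, hne⟩ := h
        obtain ⟨o', h' | h' | h' | h'⟩ := ndGraph_adj_cases h
        · obtain ⟨h0', rfl, rfl⟩ := h'
          rw [hLO, hLE, if_neg h0']
        · obtain ⟨h0', rfl, rfl⟩ := h'
          rw [hLO, hLE, if_neg h0']
        · obtain ⟨rfl, rfl⟩ := h'
          exact hOF o' (by rintro rfl; exact hne rfl)
        · obtain ⟨rfl, rfl⟩ := h'
          exact (hOF o' (by rintro rfl; exact hne Sym2.eq_swap)).symm) hr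
      rw [hLO, hLF, if_neg h0] at this
      exact (hocc o h0).mp this rfl

theorem necessity [Finite S] {Q : PStruct S ar k} (hQ : IsCQ Q) {Ep Em : Set (PStruct S ar k)}
    (hEm : Em.Finite) (hU : UniquelyCharacterizes Ep Em Q {Q' | IsCQ Q'}) :
    ∃ Q' : PStruct S ar k, IsCQ Q' ∧ CAcyclic Q' ∧ HomEquiv Q Q' := by
  obtain ⟨B, hB, hBc, hQB, f, hf, -⟩ := exists_core _ Q hQ le_rfl
  have hequiv : HomEquiv Q B := ⟨hQB, f, hf⟩
  refine ⟨B, hB, ?_, hequiv⟩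
  by_contra hac
  obtain ⟨o, ho⟩ := not_homTo_layered hBc hac
  have hU' := hU.congr hequiv
  obtain ⟨n, hn⟩ := (hEm.image (fun E => Nat.card (B.dom → E.dom))).bddAbove
  have hfit : Fits (layered B o n) Ep Em := by
    refine ⟨fun E hE => HomTo.trans ⟨_, layered_proj B o n⟩ (hU'.1.1 E hE), fun E hE hh => ?_⟩
    exact hU'.1.2 E hE (layered_homTo o n (hn ⟨E, hE, rfl⟩) hh)
  exact ho n (hU'.2 _ (layered_isCQ hB o n) hfit).1

end Necessity

end PStruct

namespace PStruct

section Sufficiency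

variable {S : Type} {ar : S → ℕ} {k : ℕ}

/-- The occurrence of a fact at a position. -/
def occAt {A : PStruct S ar k} (f : Fact A) (p : Fin (ar f.1)) : Occ A := ⟨f.1, f.2, p⟩

namespace Ranks

variable {Q : PStruct S ar k} (r : Ranks Q)

/-- The element of the occurrence is the parent of the fact. -/
def Up (o : Occ Q) : Prop := ¬ IsDist Q o.elem ∧ r.re o.elem < r.rf o.fact

/-- The fact of the occurrence is the parent of the element. -/
def Down (o : Occ Q) : Prop := ¬ IsDist Q o.elem ∧ r.rf o.fact < r.re o.elem

theorem up_or_down (o : Occ Q) (h : ¬ IsDist Q o.elem) : r.Up o ∨ r.Down o := by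
  rcases lt_or_gt_of_ne (r.ne o h) with h' | h'
  · exact Or.inl ⟨h, h'⟩
  · exact Or.inr ⟨h, h'⟩

theorem up_unique {o o' : Occ Q} (h : r.Up o) (h' : r.Up o') (hf : o.fact = o'.fact) : o = o' :=
  r.up o o' h.1 h'.1 hf h.2 h'.2

theorem down_unique {o o' : Occ Q} (h : r.Down o) (h' : r.Down o') (hf : o.elem = o'.elem) :
    o = o' :=
  r.down o o' h.1 hf h.2 h'.2

variable {X : PStruct S ar k} (g : X.dom → Q.dom)

/-- A lift of the fact `f` to `X`, in which distinguished positions hold distinguished elements,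
and children satisfy `P`. -/
def Lift (P : X.dom → Prop) (f : Fact Q) (t : Fin (ar f.1) → X.dom) : Prop :=
  t ∈ X.facts f.1 ∧ (∀ p, g (t p) = f.2.1 p) ∧ (∀ p, IsDist Q (f.2.1 p) → IsDist X (t p)) ∧
  ∀ p, r.Down (occAt f p) → P (t p)

/-- One unfolding of goodness. -/
def Cond (P : X.dom → Prop) (x : X.dom) : Prop :=
  ∀ o : Occ Q, r.Up o → o.elem = g x → ∃ t, r.Lift g P o.fact t ∧ t o.2.2 = x

/-- The subtree below `g x` can be mapped to `X` with `g x` sent to `x`. -/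
def Good (x : X.dom) : Prop := ∃ P : X.dom → Prop, (∀ y, P y → r.Cond g P y) ∧ P x

theorem Lift.mono {r : Ranks Q} {g : X.dom → Q.dom} {P P' : X.dom → Prop} (h : ∀ x, P x → P' x)
    {f : Fact Q} {t : Fin (ar f.1) → X.dom} (hl : r.Lift g P f t) : r.Lift g P' f t :=
  ⟨hl.1, hl.2.1, hl.2.2.1, fun p hp => h _ (hl.2.2.2 p hp)⟩

theorem Cond.mono {r : Ranks Q} {g : X.dom → Q.dom} {P P' : X.dom → Prop} (h : ∀ x, P x → P' x)
    {x : X.dom} (hc : r.Cond g P x) : r.Cond g P' x := by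
  intro o ho he
  obtain ⟨t, ht, hx⟩ := hc o ho he
  exact ⟨t, ht.mono h, hx⟩

theorem Good.cond {r : Ranks Q} {g : X.dom → Q.dom} {x : X.dom} (h : r.Good g x) :
    r.Cond g (r.Good g) x := by
  obtain ⟨P, hP, hx⟩ := h
  exact (hP x hx).mono fun y hy => ⟨P, hP, hy⟩

theorem Cond.good {r : Ranks Q} {g : X.dom → Q.dom} {x : X.dom} (h : r.Cond g (r.Good g) x) :
    r.Good g x :=
  ⟨r.Cond g (r.Good g), fun _ hy => hy.mono fun _ hz => hz.cond, h⟩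

/-- Top-down recursion. -/
theorem exists_rec {α β : Type} (m : α → ℕ) (par : α → Option α)
    (hpar : ∀ a b, par a = some b → m b < m a) (Φ : α → Option β → β) :
    ∃ s : α → β, ∀ a, s a = Φ a ((par a).map s) := by
  have : ∀ n, ∃ s : α → β, ∀ a, m a < n → s a = Φ a ((par a).map s) := by
    intro n
    induction n with
    | zero => exact ⟨fun a => Φ a none, fun a h => absurd h (Nat.not_lt_zero _)⟩
    | succ n ih =>
      obtain ⟨s, hs⟩ := ih
      refine ⟨fun a => Φ a ((par a).map s), fun a ha => ?_⟩
      change Φ a ((par a).map s) = _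
      congr 1
      cases hp : par a with
      | none => rfl
      | some b =>
        have := hpar a b hp
        simp only [Option.map_some, Option.some.injEq]
        exact hs b (by omega)
  choose s hs using this
  have agree : ∀ d a, m a ≤ d → ∀ n n', m a < n → m a < n' → s n a = s n' a := by
    intro d
    induction d with
    | zero =>
      intro a had n n' h1 h2
      rw [hs n a h1, hs n' a h2]
      cases hp : par a with
      | none => rfl
      | some b => have := hpar a b hp; omega
    | succ d ihd =>
      intro a had n n' h1 h2
      rw [hs n a h1, hs n' a h2]
      cases hp : par a with
      | none => rfl
      | some b =>
        have := hpar a b hp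
        simp only [Option.map_some]
        rw [ihd b (by omega) n n' (by omega) (by omega)]
  refine ⟨fun a => s (m a + 1) a, fun a => ?_⟩
  change s (m a + 1) a = _
  rw [hs (m a + 1) a (by omega)]
  cases hp : par a with
  | none => rfl
  | some b =>
    have := hpar a b hp
    simp only [Option.map_some]
    rw [agree (m b) b le_rfl (m a + 1) (m b + 1) (by omega) (by omega)]

/-- If all roots are good, there is a homomorphism. -/
theorem homTo_of_roots (hQ : IsCQ Q) (hg : IsHom X Q g)
    (hd : ∀ i j, Q.dist i = Q.dist j → X.dist i = X.dist j)
    (hre : ∀ b, ¬ IsDist Q b → (∀ o, r.Down o → o.elem ≠ b) → ∃ x, g x = b ∧ r.Good g x)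
    (hrf : ∀ f : Fact Q, (∀ o, r.Up o → o.fact ≠ f) → ∃ t, r.Lift g (r.Good g) f t) :
    HomTo Q X := by
  classical
  by_cases hX : Nonempty X.dom
  swap
  · -- no elements in X
    by_cases hE : Nonempty Q.dom
    · exfalso
      -- take an element of minimal rank among elements and facts
      have main : ∀ n, (∀ b, ¬ IsDist Q b → r.re b ≤ n → False) ∧
          (∀ f : Fact Q, ∀ p : Fin (ar f.1), r.rf f ≤ n → False) := by
        intro n
        induction n using Nat.strong_induction_on with
        | _ n ih =>
        constructor
        · intro b hb hn
          by_cases h : ∃ o, r.Down o ∧ o.elem = b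
          · obtain ⟨o, ho, rfl⟩ := h
            have := ho.2
            exact (ih _ (lt_of_lt_of_le this hn)).2 o.fact o.2.2 le_rfl
          · push Not at h
            obtain ⟨x, -⟩ := hre b hb h
            exact hX ⟨x⟩
        · intro f p hn
          by_cases h : ∃ o, r.Up o ∧ o.fact = f
          · obtain ⟨o, ho, rfl⟩ := h
            exact (ih _ (lt_of_lt_of_le ho.2 hn)).1 o.elem ho.1 le_rfl
          · push Not at h
            obtain ⟨t, -⟩ := hrf f h
            exact hX ⟨t p⟩
      obtain ⟨b⟩ := hE
      obtain ⟨R, t, ht, p, -⟩ := hQ b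
      exact (main _).2 ⟨R, t, ht⟩ p le_rfl
    · refine ⟨fun b => absurd ⟨b⟩ hE, ?_, fun i => absurd ⟨Q.dist i⟩ hE⟩
      intro R t ht
      obtain ⟨t', ht'⟩ := hrf ⟨R, t, ht⟩ (fun o _ _ => hE ⟨o.elem⟩)
      have e : (fun i => (absurd ⟨t i⟩ hE : X.dom)) = t' := funext fun i => absurd ⟨t i⟩ hE
      rw [e]
      exact ht'.1
  obtain ⟨x0⟩ := hX
  -- parents
  let pf : Fact Q → Option Q.dom := fun f =>
    if h : ∃ o, r.Up o ∧ o.fact = f then some h.choose.elem else none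
  let pe : Q.dom → Option Q.dom := fun b =>
    if h : ∃ o, r.Down o ∧ o.elem = b then pf h.choose.fact else none
  have hpf : ∀ o, r.Up o → pf o.fact = some o.elem := by
    intro o ho
    have h : ∃ o', r.Up o' ∧ o'.fact = o.fact := ⟨o, ho, rfl⟩
    have := r.up_unique h.choose_spec.1 ho h.choose_spec.2
    simp only [pf, dif_pos h, this]
  have hpf0 : ∀ f, (∀ o, r.Up o → o.fact ≠ f) → pf f = none := by
    intro f hf
    have h : ¬ ∃ o', r.Up o' ∧ o'.fact = f := by push Not; exact hf
    simp only [pf, dif_neg h]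
  have hdc : ∀ o, r.Down o → ∀ h : ∃ o', r.Down o' ∧ o'.elem = o.elem, h.choose = o :=
    fun o ho h => r.down_unique h.choose_spec.1 ho h.choose_spec.2
  have hpe : ∀ o, r.Down o → pe o.elem = pf o.fact := by
    intro o ho
    have h : ∃ o', r.Down o' ∧ o'.elem = o.elem := ⟨o, ho, rfl⟩
    simp only [pe, dif_pos h, hdc o ho h]
  have hpe_lt : ∀ a b, pe a = some b → r.re b < r.re a := by
    intro a b hab
    by_cases h : ∃ o, r.Down o ∧ o.elem = a
    · obtain ⟨o, ho, rfl⟩ := h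
      rw [hpe o ho] at hab
      by_cases h' : ∃ o', r.Up o' ∧ o'.fact = o.fact
      · obtain ⟨o', ho', he⟩ := h'
        rw [← he, hpf o' ho'] at hab
        have e : o'.elem = b := Option.some.inj hab
        have h1 := ho.2
        have h2 := ho'.2
        rw [e, he] at h2
        omega
      · push Not at h'
        rw [hpf0 _ h'] at hab
        cases hab
    · simp only [pe, dif_neg h] at hab
      cases hab
  -- chosen lifts
  let IsT : (f : Fact Q) → Option X.dom → (Fin (ar f.1) → X.dom) → Prop := fun f ox t =>
    r.Lift g (r.Good g) f t ∧ ∀ x, ox = some x → ∀ p, r.Up (occAt f p) → t p = x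
  let T : (f : Fact Q) → Option X.dom → (Fin (ar f.1) → X.dom) := fun f ox =>
    if h : ∃ t, IsT f ox t then h.choose else fun _ => x0
  have hT : ∀ f ox, (∃ t, IsT f ox t) → IsT f ox (T f ox) := by
    intro f ox h
    simp only [T, dif_pos h]
    exact h.choose_spec
  let Rt : Q.dom → X.dom := fun b =>
    if h : ∃ i, b = Q.dist i then X.dist h.choose else
      if h : ∃ x, g x = b ∧ r.Good g x then h.choose else x0
  let Φ : Q.dom → Option X.dom → X.dom := fun b ox =>
    if h : ∃ o, r.Down o ∧ o.elem = b then T h.choose.fact ox h.choose.2.2 else Rt b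
  obtain ⟨s, hs⟩ := exists_rec r.re pe hpe_lt Φ
  have hs_down : ∀ o, r.Down o → s o.elem = T o.fact ((pf o.fact).map s) o.2.2 := by
    intro o ho
    have h : ∃ o', r.Down o' ∧ o'.elem = o.elem := ⟨o, ho, rfl⟩
    rw [hs, hpe o ho]
    simp only [Φ, dif_pos h]
    rw [hdc o ho h]
  have hs_root : ∀ b, (∀ o, r.Down o → o.elem ≠ b) → s b = Rt b := by
    intro b hb
    have h : ¬ ∃ o, r.Down o ∧ o.elem = b := by push Not; exact hb
    rw [hs]
    simp only [Φ, dif_neg h]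
  have hs_dist : ∀ i, s (Q.dist i) = X.dist i := by
    intro i
    have h : ∃ j, Q.dist i = Q.dist j := ⟨i, rfl⟩
    rw [hs_root _ (fun o ho he => ho.1 ⟨i, he⟩)]
    simp only [Rt, dif_pos h]
    exact (hd _ _ h.choose_spec).symm
  have hfact_of : ∀ f, (∀ o, r.Up o → o.fact = f → g (s o.elem) = o.elem ∧ r.Good g (s o.elem)) →
      IsT f ((pf f).map s) (T f ((pf f).map s)) := by
    intro f hf
    apply hT
    by_cases h : ∃ o, r.Up o ∧ o.fact = f
    · obtain ⟨o, ho, rfl⟩ := h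
      obtain ⟨h1, h2⟩ := hf o ho rfl
      obtain ⟨t, ht, hx⟩ := h2.cond o ho h1.symm
      refine ⟨t, ht, ?_⟩
      intro x hx' p hp
      rw [hpf o ho] at hx'
      have e : s o.elem = x := Option.some.inj hx'
      have e2 : occAt o.fact p = o := r.up_unique hp ho rfl
      have e3 : p = o.2.2 := by
        have := congrArg (fun z : Occ Q => (z.1, HEq z.2.2 p)) e2
        have h3 : HEq o.2.2 p := by
          have := (congrArg Prod.snd this)
          simp only [occAt] at this
          exact this.mp HEq.rfl
        exact (eq_of_heq h3).symm
      rw [e3, hx, e]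
    · push Not at h
      obtain ⟨t, ht⟩ := hrf f h
      refine ⟨t, ht, ?_⟩
      intro x hx
      rw [hpf0 f h] at hx
      cases hx
  have hgood : ∀ n b, r.re b ≤ n → ¬ IsDist Q b → g (s b) = b ∧ r.Good g (s b) := by
    intro n
    induction n using Nat.strong_induction_on with
    | _ n ih =>
    intro b hn hb
    by_cases h : ∃ o, r.Down o ∧ o.elem = b
    · obtain ⟨o, ho, rfl⟩ := h
      have := hfact_of o.fact (fun o' ho' he => by
        refine ih (r.re o'.elem) ?_ o'.elem le_rfl ho'.1
        have h1 := ho.2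
        have h2 := ho'.2
        rw [he] at h2
        omega)
      rw [hs_down o ho]
      exact ⟨this.1.2.1 _, this.1.2.2.2 _ ho⟩
    · push Not at h
      rw [hs_root b h]
      have hb' : ¬ ∃ i, b = Q.dist i := hb
      have hx := hre b hb h
      simp only [Rt, dif_neg hb', dif_pos hx]
      exact hx.choose_spec
  refine ⟨s, ?_, hs_dist⟩
  intro R t ht
  let f : Fact Q := ⟨R, t, ht⟩
  have hf := hfact_of f (fun o ho _ => hgood _ _ le_rfl ho.1)
  have e : (fun i => s (t i)) = T f ((pf f).map s) := by
    funext p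
    by_cases hp : IsDist Q (t p)
    · obtain ⟨i, hi⟩ := hp
      obtain ⟨j, hj⟩ := hf.1.2.2.1 p ⟨i, hi⟩
      rw [hi, hs_dist, hj]
      apply hd
      have h1 := hf.1.2.1 p
      rw [hj, hg.2] at h1
      rw [h1]
      exact hi.symm
    · rcases r.up_or_down (occAt f p) hp with hu | hdn
      · refine (hf.2 (s (t p)) ?_ p hu).symm
        rw [show pf f = some (t p) from hpf _ hu]
        rfl
      · exact hs_down (occAt f p) hdn
  rw [e]
  exact hf.1.1

end Ranks

end Sufficiency

end PStruct

namespace PStruct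

section Examples

variable {S : Type} {ar : S → ℕ} {k : ℕ}

/-- Negative example detecting that distinguished elements have been split. -/
def splitEx (Q : PStruct S ar k) (c : Fin k → Bool) : PStruct S ar k where
  dom := Q.dom × Bool
  finite := inferInstance
  facts R := {t | (fun p => (t p).1) ∈ Q.facts R}
  dist i := (Q.dist i, c i)

/-- Negative example attached to a root `b` of the forest. -/
def rootEx [Finite S] (Q : PStruct S ar k) (r : Ranks Q) (b : Q.dom ⊕ Fact Q) :
    PStruct S ar k where
  dom := Q.dom × (Bool × Option (Fact Q))
  finite := inferInstance
  facts R := {t | ∃ h : (fun p => (t p).1) ∈ Q.facts R,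
    (∀ p, ¬ IsDist Q (t p).1 →
      (∀ f, (t p).2.2 = some f → ∃ o, r.Up o ∧ o.elem = (t p).1 ∧ o.fact = f) ∧
      (b = Sum.inl (t p).1 → (t p).2.2 ≠ none)) ∧
    (((∃ o, r.Up o ∧ o.fact = ⟨R, _, h⟩) ∨ b = Sum.inr ⟨R, _, h⟩) →
      ∃ p, (IsDist Q (t p).1 ∧ (t p).2.1 = false) ∨
        (r.Up (occAt ⟨R, _, h⟩ p) ∧ (t p).2.2 ≠ some ⟨R, _, h⟩) ∨
        (r.Down (occAt ⟨R, _, h⟩ p) ∧ (t p).2.2 ≠ none))}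
  dist i := (Q.dist i, true, none)

theorem not_homTo_splitEx {Q : PStruct S ar k} {c : Fin k → Bool}
    (hc : ∃ i j, Q.dist i = Q.dist j ∧ c i ≠ c j) : ¬ HomTo Q (splitEx Q c) := by
  rintro ⟨h, hh⟩
  obtain ⟨i, j, hij, hne⟩ := hc
  have h1 := hh.2 i
  have h2 := hh.2 j
  rw [hij, h2] at h1
  exact hne (congrArg Prod.snd h1).symm

theorem not_homTo_rootEx [Finite S] {Q : PStruct S ar k} (hQ : IsCQ Q) (hcore : IsCore Q)
    (r : Ranks Q) {b : Q.dom ⊕ Fact Q}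
    (hb1 : ∀ a, b = Sum.inl a → ¬ IsDist Q a)
    (hb2 : ∀ f, b = Sum.inr f → ∀ o, r.Up o → o.fact ≠ f) : ¬ HomTo Q (rootEx Q r b) := by
  classical
  rintro ⟨φ, hφ⟩
  have hproj : IsHom (rootEx Q r b) Q (fun x => x.1) := ⟨fun _ _ ⟨h, _⟩ => h, fun _ => rfl⟩
  obtain ⟨u, hu, hu2⟩ := hcore.exists_inv (hproj.comp hφ)
  have hs := hφ.comp hu
  set s : Q.dom → (rootEx Q r b).dom := fun x => φ (u x) with hsdef
  have hs1 : ∀ x, (s x).1 = x := hu2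
  let c : Q.dom → Option (Fact Q) := fun x => (s x).2.2
  have hdist : ∀ a, IsDist Q a → (s a).2.1 = true := by
    rintro a ⟨i, rfl⟩
    rw [show s (Q.dist i) = (Q.dist i, true, none) from hs.2 i]
  -- the content of the facts
  have hfacts : ∀ f : Fact Q,
      (∀ p, ¬ IsDist Q (f.2.1 p) →
        (∀ f', c (f.2.1 p) = some f' → ∃ o, r.Up o ∧ o.elem = f.2.1 p ∧ o.fact = f') ∧
        (b = Sum.inl (f.2.1 p) → c (f.2.1 p) ≠ none)) ∧
      (((∃ o, r.Up o ∧ o.fact = f) ∨ b = Sum.inr f) →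
        ∃ p, (r.Up (occAt f p) ∧ c (f.2.1 p) ≠ some f) ∨
          (r.Down (occAt f p) ∧ c (f.2.1 p) ≠ none)) := by
    rintro ⟨R, t, ht⟩
    obtain ⟨h, h1, h2⟩ := hs.1 R t ht
    have e : (fun p => (s (t p)).1) = t := funext fun p => hs1 _
    simp only [e] at h2
    constructor
    · intro p hp
      have := h1 p (by rw [hs1]; exact hp)
      rw [hs1] at this
      exact this
    · intro hyp
      obtain ⟨p, hp⟩ := h2 hyp
      refine ⟨p, ?_⟩
      rcases hp with ⟨hd, hf⟩ | hp
      · rw [hs1] at hd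
        rw [hdist _ hd] at hf
        cases hf
      · have hoc : ∀ (t' : Fin (ar R) → Q.dom) (h' : t' ∈ Q.facts R), t' = t →
            occAt (⟨R, t', h'⟩ : Fact Q) p = occAt (⟨R, t, ht⟩ : Fact Q) p := by
          rintro t' h' rfl
          rfl
        rw [hoc _ h e] at hp
        exact hp
  have hnone : ∀ a, ¬ IsDist Q a → c a = none := by
    by_contra hcon
    push Not at hcon
    obtain ⟨a0, ha0⟩ := hcon
    obtain ⟨a, ⟨had, hac⟩, hmax⟩ := Set.exists_max_image {a | ¬ IsDist Q a ∧ c a ≠ none} r.re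
      (Set.toFinite _) ⟨a0, ha0⟩
    obtain ⟨f', hf'⟩ := Option.ne_none_iff_exists'.mp hac
    obtain ⟨R, t, ht, p, rfl⟩ := hQ a
    obtain ⟨o, ho, hoe, rfl⟩ := ((hfacts ⟨R, t, ht⟩).1 p had).1 f' hf'
    obtain ⟨q, hq⟩ := (hfacts o.fact).2 (Or.inl ⟨o, ho, rfl⟩)
    rcases hq with ⟨h1, h2⟩ | ⟨h1, h2⟩
    · have e : occAt o.fact q = o := r.up_unique h1 ho rfl
      have e2 : o.fact.2.1 q = o.elem := congrArg Occ.elem e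
      rw [e2, hoe] at h2
      exact h2 hf'
    · have hle := hmax (o.fact.2.1 q) ⟨h1.1, h2⟩
      have l1 := ho.2
      have l2 : r.rf o.fact < r.re (o.fact.2.1 q) := h1.2
      rw [hoe] at l1
      exact absurd hle (not_le.mpr (l1.trans l2))
  rcases hb : b with a | f
  · obtain ⟨R, t, ht, p, rfl⟩ := hQ a
    have hnd := hb1 _ hb
    exact ((hfacts ⟨R, t, ht⟩).1 p hnd).2 hb (hnone _ hnd)
  · obtain ⟨p, hp⟩ := (hfacts f).2 (Or.inr hb)
    rcases hp with ⟨h1, -⟩ | ⟨h1, h2⟩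
    · exact hb2 f hb _ h1 rfl
    · exact h2 (hnone _ h1.1)

theorem homTo_splitEx {Q X : PStruct S ar k} {g : X.dom → Q.dom} (hg : IsHom X Q g)
    {i j : Fin k} (h : Q.dist i = Q.dist j) (hne : X.dist i ≠ X.dist j) :
    ∃ c : Fin k → Bool, (∃ i j, Q.dist i = Q.dist j ∧ c i ≠ c j) ∧ HomTo X (splitEx Q c) := by
  classical
  refine ⟨fun l => decide (X.dist l = X.dist i), ⟨i, j, h, ?_⟩,
    fun x => (g x, decide (x = X.dist i)), ?_, ?_⟩
  · simp [hne.symm]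
  · intro R t ht
    exact hg.1 R t ht
  · intro l
    change (g (X.dist l), _) = (Q.dist l, _)
    rw [hg.2]

theorem homTo_rootEx [Finite S] {Q X : PStruct S ar k} (r : Ranks Q)
    {g : X.dom → Q.dom} (hg : IsHom X Q g) (b : Q.dom ⊕ Fact Q)
    (hb1 : ∀ a, b = Sum.inl a → ¬ ∃ x, g x = a ∧ r.Good g x)
    (hb2 : ∀ f, b = Sum.inr f → (∀ o, r.Up o → o.fact ≠ f) ∧ ¬ ∃ t, r.Lift g (r.Good g) f t) :
    HomTo X (rootEx Q r b) := by
  classical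
  let Bad : X.dom → Occ Q → Prop := fun x o =>
    (r.Up o ∧ o.elem = g x) ∧ ¬ ∃ t, r.Lift g (r.Good g) o.fact t ∧ t o.2.2 = x
  let c : X.dom → Option (Fact Q) := fun x =>
    if h : ∃ o, Bad x o then some h.choose.fact else none
  have hc_some : ∀ x f, c x = some f → ∃ o, Bad x o ∧ o.fact = f := by
    intro x f hx
    by_cases h : ∃ o, Bad x o
    · simp only [c, dif_pos h, Option.some.injEq] at hx
      exact ⟨_, h.choose_spec, hx⟩
    · simp only [c, dif_neg h] at hx
      cases hx
  have hc_none : ∀ x, c x = none → r.Good g x := by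
    intro x hx
    by_cases h : ∃ o, Bad x o
    · simp only [c, dif_pos h] at hx
      cases hx
    · apply Ranks.Cond.good
      intro o ho he
      by_contra hcon
      exact h ⟨o, ⟨ho, he⟩, hcon⟩
  refine ⟨fun x => (g x, decide (IsDist X x), c x), ?_, ?_⟩
  · intro R t ht
    refine ⟨hg.1 R t ht, ?_, ?_⟩
    · intro p hp
      constructor
      · intro f hf
        obtain ⟨o, ho, h⟩ := hc_some _ _ hf
        exact ⟨o, ho.1.1, ho.1.2, h⟩
      · intro hbp hcn
        exact hb1 _ hbp ⟨_, rfl, hc_none _ hcn⟩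
    · intro hyp
      set f : Fact Q := ⟨R, fun p => g (t p), hg.1 R t ht⟩ with hf
      by_contra hcon
      push Not at hcon
      have hlift : r.Lift g (r.Good g) f t := by
        refine ⟨ht, fun p => rfl, ?_, ?_⟩
        · intro p hp
          have := (hcon p).1 hp
          change decide (IsDist X (t p)) ≠ false at this
          simpa using this
        · intro p hp
          exact hc_none _ ((hcon p).2.2 hp)
      rcases hyp with ⟨o, ho, hof⟩ | hbf
      · obtain ⟨p, rfl⟩ : ∃ p, o = occAt f p := by
          rw [← hof]; exact ⟨o.2.2, rfl⟩
        have h1 : c (t p) = some f := (hcon p).2.1 ho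
        obtain ⟨o', ho', hof'⟩ := hc_some _ _ h1
        have e : o' = occAt f p := r.up_unique ho'.1.1 ho hof'
        rw [e] at ho'
        exact ho'.2 ⟨t, hlift, rfl⟩
      · exact (hb2 f hbf).2 ⟨t, hlift⟩
  · intro i
    have h1 : c (X.dist i) = none := by
      have : ¬ ∃ o, Bad (X.dist i) o := by
        rintro ⟨o, ho, -⟩
        exact ho.1.1 ⟨i, by rw [ho.2, hg.2]⟩
      simp only [c, dif_neg this]
    have h2 : IsDist X (X.dist i) := ⟨i, rfl⟩
    change (g (X.dist i), decide (IsDist X (X.dist i)), c (X.dist i)) = (Q.dist i, true, none)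
    rw [h1, hg.2]
    simp [h2]

/-- The family of negative examples. -/
noncomputable def negEx [Finite S] (Q : PStruct S ar k) (r : Ranks Q) :
    (Fin k → Bool) ⊕ (Q.dom ⊕ Fact Q) → PStruct S ar k :=
  Sum.elim (splitEx Q) (rootEx Q r)

theorem characterize [Finite S] {Q : PStruct S ar k} (hQ : IsCQ Q) (hcore : IsCore Q)
    (r : Ranks Q) : ∃ I : Set ((Fin k → Bool) ⊕ (Q.dom ⊕ Fact Q)),
      UniquelyCharacterizes {Q} (negEx Q r '' I) Q {Q' | IsCQ Q'} := by
  classical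
  refine ⟨{z | ¬ HomTo Q (negEx Q r z)}, ⟨?_, ?_⟩, ?_⟩
  · rintro E rfl
    exact HomTo.rfl' _
  · rintro E ⟨z, hz, rfl⟩
    exact hz
  · intro X hX hfit
    have hXQ : HomTo X Q := hfit.1 Q rfl
    refine ⟨?_, hXQ⟩
    obtain ⟨g, hg⟩ := hXQ
    have hneg : ∀ z, ¬ HomTo Q (negEx Q r z) → ¬ HomTo X (negEx Q r z) :=
      fun z hz => hfit.2 _ ⟨z, hz, rfl⟩
    apply r.homTo_of_roots g hQ hg
    · intro i j hij
      by_contra hne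
      obtain ⟨c, hc, hXc⟩ := homTo_splitEx hg hij hne
      exact hneg (Sum.inl c) (not_homTo_splitEx hc) hXc
    · intro b hb hroot
      by_contra hcon
      refine hneg (Sum.inr (Sum.inl b)) (not_homTo_rootEx hQ hcore r ?_ ?_)
        (homTo_rootEx r hg _ ?_ ?_)
      · intro a ha
        cases ha
        exact hb
      · intro f hf
        cases hf
      · intro a ha
        cases ha
        exact hcon
      · intro f hf
        cases hf
    · intro f hroot
      by_contra hcon
      refine hneg (Sum.inr (Sum.inr f)) (not_homTo_rootEx hQ hcore r ?_ ?_)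
        (homTo_rootEx r hg _ ?_ ?_)
      · intro a ha
        cases ha
      · intro f' hf
        cases hf
        exact hroot
      · intro a ha
        cases ha
      · intro f' hf
        cases hf
        exact ⟨hroot, hcon⟩

end Examples

end PStruct

namespace PStruct

section Size

variable {S : Type} {ar : S → ℕ} {k : ℕ}

theorem size_le [Fintype S] (A : PStruct S ar k) : size A ≤ ∑ R, Nat.card A.dom ^ ar R := by
  have h := Nat.card_le_card_of_injective
    (fun f : Fact A => (⟨f.1, f.2.1⟩ : Σ R : S, (Fin (ar R) → A.dom))) (by
      rintro ⟨R, t, ht⟩ ⟨R', t', ht'⟩ h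
      cases h
      rfl)
  rw [Nat.card_sigma] at h
  simpa [size, Nat.card_fun] using h

theorem card_dom_le [Fintype S] {A : PStruct S ar k} (hA : IsCQ A) :
    Nat.card A.dom ≤ size A * ∑ R, ar R := by
  have h1 : ∀ x : A.dom, ∃ f : Fact A, ∃ j : Fin (ar f.1), f.2.1 j = x := by
    intro x
    obtain ⟨R, t, ht, j, hj⟩ := hA x
    exact ⟨⟨R, t, ht⟩, j, hj⟩
  choose f j hj using h1
  have hle : ∀ R, ar R ≤ ∑ R, ar R := fun R =>
    Finset.single_le_sum (f := ar) (fun _ _ => Nat.zero_le _) (Finset.mem_univ R)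
  have h := Nat.card_le_card_of_injective
    (fun x => ((f x, Fin.castLE (hle _) (j x)) : Fact A × Fin (∑ R, ar R))) (by
      intro x y hxy
      obtain ⟨e1, e2⟩ := Prod.ext_iff.mp hxy
      dsimp only at e1 e2
      have e3 : (j x).1 = (j y).1 := congrArg Fin.val e2
      have : ∀ (f f' : Fact A) (j : Fin (ar f.1)) (j' : Fin (ar f'.1)), f = f' → j.1 = j'.1 →
          f.2.1 j = f'.2.1 j' := by
        rintro f f' j j' rfl hjj
        rw [Fin.ext hjj]
      rw [← hj x, ← hj y]
      exact this _ _ _ _ e1 e3)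
  simpa [size, Nat.card_prod] using h

theorem totalSize_image_le {ι : Type} [Finite ι] (F : ι → PStruct S ar k) (I : Set ι) (M : ℕ)
    (hM : ∀ i, size (F i) + 1 ≤ M) : totalSize (F '' I) ≤ Nat.card ι * M := by
  have hfin : (F '' I).Finite := (Set.toFinite I).image F
  unfold totalSize
  rw [finsum_mem_eq_finite_toFinset_sum _ hfin]
  calc _ ≤ hfin.toFinset.card • M := by
        apply Finset.sum_le_card_nsmul
        intro B hB
        obtain ⟨i, -, rfl⟩ := hfin.mem_toFinset.mp hB
        exact hM i
    _ ≤ Nat.card ι * M := by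
        rw [smul_eq_mul]
        apply Nat.mul_le_mul_right
        rw [← Set.ncard_eq_toFinset_card _ hfin]
        exact (Set.ncard_image_le (Set.toFinite I)).trans (Set.ncard_le_card I)

theorem totalSize_singleton (A : PStruct S ar k) : totalSize {A} = size A + 1 := by
  simp [totalSize]

/-- The bound on total size. -/
noncomputable def bnd [Fintype S] (ar : S → ℕ) (k : ℕ) : Polynomial ℕ :=
  Polynomial.X + 1 + (Polynomial.C (2 ^ k) +
    (Polynomial.X * Polynomial.C (∑ R, ar R) + Polynomial.X)) *
    (∑ R, (Polynomial.X * Polynomial.C (∑ R, ar R) *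
      (Polynomial.C 2 * (Polynomial.X + 1))) ^ ar R + 1)

theorem bnd_eval [Fintype S] (n : ℕ) : (bnd ar k).eval n =
    n + 1 + (2 ^ k + (n * (∑ R, ar R) + n)) *
      (∑ R, (n * (∑ R, ar R) * (2 * (n + 1))) ^ ar R + 1) := by
  simp [bnd, Polynomial.eval_finsetSum]

theorem sufficiency [Fintype S] {Q : PStruct S ar k} (hQ : IsCQ Q) (hac : CAcyclic Q) :
    ∃ Ep Em : Set (PStruct S ar k), Ep.Finite ∧ Em.Finite ∧
      UniquelyCharacterizes Ep Em Q {Q' | IsCQ Q'} ∧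
      totalSize Ep + totalSize Em ≤ (bnd ar k).eval (size Q) := by
  obtain ⟨B, hB, hBc, hQB, f, hf, hfi⟩ := exists_core _ Q hQ le_rfl
  obtain ⟨r⟩ := (CAcyclic.of_injective hf hfi hac).exists_ranks
  obtain ⟨I, hI⟩ := characterize hB hBc r
  refine ⟨{B}, negEx B r '' I, Set.finite_singleton _, (Set.toFinite I).image _,
    hI.congr ⟨⟨f, hf⟩, hQB⟩, ?_⟩
  have hsz : size B ≤ size Q := size_le_of_injective hf hfi
  have hdom := card_dom_le hB
  set n := size B with hn
  set N := size Q
  set a := ∑ R, ar R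
  have hM : ∀ z, size (negEx B r z) + 1 ≤ ∑ R, (n * a * (2 * (n + 1))) ^ ar R + 1 := by
    intro z
    have hz : Nat.card (negEx B r z).dom ≤ n * a * (2 * (n + 1)) := by
      rcases z with c | b
      · have : Nat.card (negEx B r (Sum.inl c)).dom = Nat.card (B.dom × Bool) := rfl
        rw [this, Nat.card_prod]
        apply Nat.mul_le_mul hdom
        simp
      · have : Nat.card (negEx B r (Sum.inr b)).dom =
          Nat.card (B.dom × (Bool × Option (Fact B))) := rfl
        rw [this, Nat.card_prod, Nat.card_prod, Finite.card_option]
        apply Nat.mul_le_mul hdom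
        simp [hn, size]
    have := size_le (negEx B r z)
    have h2 : ∑ R, Nat.card (negEx B r z).dom ^ ar R ≤ ∑ R, (n * a * (2 * (n + 1))) ^ ar R :=
      Finset.sum_le_sum fun R _ => Nat.pow_le_pow_left hz _
    omega
  have hT := totalSize_image_le (negEx B r) I _ hM
  have hcard : Nat.card ((Fin k → Bool) ⊕ (B.dom ⊕ Fact B)) ≤ 2 ^ k + (n * a + n) := by
    rw [Nat.card_sum, Nat.card_sum, Nat.card_fun]
    have : Nat.card (Fact B) = n := rfl
    rw [this]
    simpa using hdom
  rw [totalSize_singleton, bnd_eval]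
  calc _ ≤ n + 1 + (2 ^ k + (n * a + n)) * (∑ R, (n * a * (2 * (n + 1))) ^ ar R + 1) :=
        Nat.add_le_add_left (hT.trans (Nat.mul_le_mul_right _ hcard)) _
    _ ≤ _ := by gcongr

end Size

end PStruct

/-- A k-ary CQ is uniquely characterizable by finitely many positive and negative examples
w.r.t. the class of all k-ary CQs iff it is logically equivalent to a c-acyclic CQ;
moreover, for c-acyclic CQs a uniquely characterizing set of examples can be constructed
in polynomial time (in particular, of total size bounded by a fixed polynomial). -/
theorem stmt_12 (S : Type) [Finite S] (ar : S → ℕ) (k : ℕ) :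
    (∀ Q : PStruct S ar k, IsCQ Q →
      ((∃ Ep Em : Set (PStruct S ar k), Ep.Finite ∧ Em.Finite ∧
          UniquelyCharacterizes Ep Em Q {Q' | IsCQ Q'}) ↔
        ∃ Q' : PStruct S ar k, IsCQ Q' ∧ CAcyclic Q' ∧ HomEquiv Q Q')) ∧
    ∃ p : Polynomial ℕ, ∀ Q : PStruct S ar k, IsCQ Q → CAcyclic Q →
      ∃ Ep Em : Set (PStruct S ar k), Ep.Finite ∧ Em.Finite ∧
        UniquelyCharacterizes Ep Em Q {Q' | IsCQ Q'} ∧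
        totalSize Ep + totalSize Em ≤ p.eval (size Q) := by
  haveI := Fintype.ofFinite S
  refine ⟨fun Q hQ => ⟨?_, ?_⟩, bnd ar k, fun Q hQ hac => sufficiency hQ hac⟩
  · rintro ⟨Ep, Em, -, hEm, hU⟩
    exact necessity hQ hEm hU
  · rintro ⟨Q', hQ', hac, he⟩
    obtain ⟨Ep, Em, h1, h2, h3, -⟩ := sufficiency hQ' hac
    exact ⟨Ep, Em, h1, h2, h3.congr ⟨he.2, he.1⟩⟩
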